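/- Every θ-weakly regular topological space is both sw-regular and wθ-regular. -/

import Mathlib

open Set Topology TopologicalSpace

universe u v w

/-- A set `U` in a topological space is *θ-open* if each of its points has an open
neighborhood whose closure is contained in `U`. -/
def IsThetaOpen {X : Type*} [TopologicalSpace X] (U : Set X) : Prop :=
  ∀ x ∈ U, ∃ O : Set X, IsOpen O ∧ x ∈ O ∧ closure O ⊆ U

/-- `V` is a θ-open subset of the subspace `A ⊆ X` (with its subspace topology). -/
def IsThetaOpenIn {X : Type*} [TopologicalSpace X] (V A : Set X) : Prop :=
  V ⊆ A ∧ IsThetaOpen ((Subtype.val ⁻¹' V) : Set A)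

/-- `C(f|A)`: the set of points of `A` at which the restriction `f|A : A → Y`
(with `A` carrying the subspace topology) is continuous. -/
def ContPts {X Y : Type*} [TopologicalSpace X] [TopologicalSpace Y] (f : X → Y) (A : Set X) :
    Set X :=
  {x | ∃ hx : x ∈ A, ContinuousAt (A.restrict f) ⟨x, hx⟩}

/-- `f` is scatteredly continuous if for every nonempty `A ⊆ X` the set `C(f|A)` is nonempty. -/
def ScatteredlyContinuous {X Y : Type*} [TopologicalSpace X] [TopologicalSpace Y]
    (f : X → Y) : Prop :=
  ∀ A : Set X, A.Nonempty → (ContPts f A).Nonempty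

/-- `f` is weakly discontinuous if for every nonempty `A ⊆ X` the set `C(f|A)` has
nonempty interior in `A`. -/
def WeaklyDiscontinuous {X Y : Type*} [TopologicalSpace X] [TopologicalSpace Y]
    (f : X → Y) : Prop :=
  ∀ A : Set X, A.Nonempty → (interior ((Subtype.val ⁻¹' ContPts f A) : Set A)).Nonempty

/-- `f` is θ-weakly discontinuous if for every nonempty `A ⊆ X` the set `C(f|A)` contains
a nonempty θ-open subset of the subspace `A`. -/
def ThetaWeaklyDiscontinuous {X Y : Type*} [TopologicalSpace X] [TopologicalSpace Y]
    (f : X → Y) : Prop :=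
  ∀ A : Set X, A.Nonempty → ∃ V : Set X, V.Nonempty ∧ V ⊆ ContPts f A ∧ IsThetaOpenIn V A

/-- `X` is sw-regular if every scatteredly continuous function from any topological space
to `X` is weakly discontinuous. -/
def SwRegular.{t, s} (X : Type s) [TopologicalSpace X] : Prop :=
  ∀ (Z : Type t) (_ : TopologicalSpace Z) (f : Z → X),
    ScatteredlyContinuous f → WeaklyDiscontinuous f

/-- `X` is wθ-regular if every weakly discontinuous function from `X` to any topological
space is θ-weakly discontinuous. -/
def WThetaRegular.{t, s} (X : Type s) [TopologicalSpace X] : Prop :=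
  ∀ (Y : Type t) (_ : TopologicalSpace Y) (f : X → Y),
    WeaklyDiscontinuous f → ThetaWeaklyDiscontinuous f

/-- A bijection (given as an equivalence) is a θ-weak homeomorphism if it and its inverse
are θ-weakly discontinuous. -/
def IsThetaWeakHomeomorph {X Y : Type*} [TopologicalSpace X] [TopologicalSpace Y]
    (e : X ≃ Y) : Prop :=
  ThetaWeaklyDiscontinuous (e : X → Y) ∧ ThetaWeaklyDiscontinuous (e.symm : Y → X)

/-- A bijection (given as an equivalence) is a weak homeomorphism if it and its inverse
are weakly discontinuous. -/
def IsWeakHomeomorph {X Y : Type*} [TopologicalSpace X] [TopologicalSpace Y]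
    (e : X ≃ Y) : Prop :=
  WeaklyDiscontinuous (e : X → Y) ∧ WeaklyDiscontinuous (e.symm : Y → X)

/-- `X` is θ-weakly regular if it is θ-weakly homeomorphic to a regular space. -/
def ThetaWeaklyRegular.{t, s} (X : Type s) [TopologicalSpace X] : Prop :=
  ∃ (Y : Type t) (_ : TopologicalSpace Y), RegularSpace Y ∧
    ∃ e : X ≃ Y, IsThetaWeakHomeomorph e

/-- `X` is weakly regular if it is weakly homeomorphic to a regular space. -/
def WeaklyRegular.{t, s} (X : Type s) [TopologicalSpace X] : Prop :=
  ∃ (Y : Type t) (_ : TopologicalSpace Y), RegularSpace Y ∧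
    ∃ e : X ≃ Y, IsWeakHomeomorph e

section ThetaWeakRegularity

variable {X Y Z : Type*} [TopologicalSpace X] [TopologicalSpace Y] [TopologicalSpace Z]

theorem mem_contPts {f : X → Y} {A : Set X} {x : X} :
    x ∈ ContPts f A ↔ x ∈ A ∧ ContinuousWithinAt f A x := by
  constructor
  · rintro ⟨hx, h⟩
    exact ⟨hx, (continuousWithinAt_iff_continuousAt_domRestrict f hx).2 h⟩
  · rintro ⟨hx, h⟩
    exact ⟨hx, (continuousWithinAt_iff_continuousAt_domRestrict f hx).1 h⟩

theorem preimage_val_contPts (f : X → Y) (A : Set X) :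
    ((↑) ⁻¹' ContPts f A : Set A) = {x | ContinuousAt (A.domRestrict f) x} := by
  ext x
  exact ⟨fun ⟨_, h⟩ => h, fun h => ⟨x.2, h⟩⟩

theorem isThetaOpenIn_iff {V A : Set X} :
    IsThetaOpenIn V A ↔
      V ⊆ A ∧ ∀ x ∈ V, ∃ O, IsOpen O ∧ x ∈ O ∧ A ∩ closure (A ∩ O) ⊆ V := by
  refine and_congr_right fun hVA => ⟨fun h x hx => ?_, fun h x hx => ?_⟩
  · obtain ⟨_, ⟨O, hO, rfl⟩, hxO, hcl⟩ := h ⟨x, hVA hx⟩ hx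
    refine ⟨O, hO, hxO, fun y hy => ?_⟩
    refine @hcl ⟨y, hy.1⟩ ?_
    rw [closure_subtype, Subtype.image_preimage_coe]
    exact hy.2
  · obtain ⟨O, hO, hxO, hcl⟩ := h x hx
    refine ⟨Subtype.val ⁻¹' O, hO.preimage continuous_subtype_val, hxO, fun y hy => hcl ⟨y.2, ?_⟩⟩
    rwa [closure_subtype, Subtype.image_preimage_coe] at hy

theorem weaklyDiscontinuous_iff {f : X → Y} :
    WeaklyDiscontinuous f ↔
      ∀ A : Set X, A.Nonempty → ∃ U, IsOpen U ∧ (A ∩ U).Nonempty ∧ ContinuousOn f (A ∩ U) := by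
  refine forall₂_congr fun A _ => ⟨?_, ?_⟩
  · rintro ⟨x, hx⟩
    obtain ⟨_, hsub, ⟨U, hU, rfl⟩, hxU⟩ := mem_interior.1 hx
    refine ⟨U, hU, ⟨x, x.2, hxU⟩, fun y hy => ?_⟩
    have : (⟨y, hy.1⟩ : A) ∈ ((↑) ⁻¹' U : Set A) := hy.2
    exact (mem_contPts.1 (hsub this)).2.mono inter_subset_left
  · rintro ⟨U, hU, ⟨x, hx⟩, hf⟩
    refine ⟨⟨x, hx.1⟩, mem_interior.2
      ⟨Subtype.val ⁻¹' U, fun y hy => mem_contPts.2 ⟨y.2, ?_⟩, hU.preimage continuous_subtype_val, hx.2⟩⟩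
    exact (continuousWithinAt_inter (hU.mem_nhds hy)).1 (hf y ⟨y.2, hy⟩)

theorem ScatteredlyContinuous.exists_continuousWithinAt {f : X → Y} (hf : ScatteredlyContinuous f)
    {A : Set X} (hA : A.Nonempty) : ∃ x ∈ A, ContinuousWithinAt f A x :=
  (hf A hA).imp fun _ => mem_contPts.1

theorem ThetaWeaklyDiscontinuous.weaklyDiscontinuous {f : X → Y}
    (hf : ThetaWeaklyDiscontinuous f) : WeaklyDiscontinuous f := by
  intro A hA
  obtain ⟨V, ⟨x, hx⟩, hV, hVA, hθ⟩ := hf A hA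
  obtain ⟨O, hO, hxO, hcl⟩ := hθ ⟨x, hVA hx⟩ hx
  exact ⟨⟨x, hVA hx⟩, mem_interior.2 ⟨O, fun y hy => hV (hcl (subset_closure hy)), hO, hxO⟩⟩

theorem Continuous.weaklyDiscontinuous {f : X → Y} (hf : Continuous f) :
    WeaklyDiscontinuous f :=
  weaklyDiscontinuous_iff.2 fun _ hA => ⟨univ, isOpen_univ, by simpa using hA, hf.continuousOn⟩

theorem ScatteredlyContinuous.comp_weaklyDiscontinuous {g : Y → Z} {f : X → Y}
    (hg : ScatteredlyContinuous g) (hf : WeaklyDiscontinuous f) :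
    ScatteredlyContinuous (g ∘ f) := by
  intro A hA
  obtain ⟨U, hU, hAU, hfU⟩ := weaklyDiscontinuous_iff.1 hf A hA
  obtain ⟨_, ⟨x, hx, rfl⟩, hgx⟩ := hg.exists_continuousWithinAt (hAU.image f)
  refine ⟨x, mem_contPts.2 ⟨hx.1, (continuousWithinAt_inter (hU.mem_nhds hx.2)).1 ?_⟩⟩
  exact hgx.comp (hfU x hx) (mapsTo_image f _)

theorem WeaklyDiscontinuous.comp {g : Y → Z} {f : X → Y}
    (hg : WeaklyDiscontinuous g) (hf : WeaklyDiscontinuous f) :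
    WeaklyDiscontinuous (g ∘ f) := by
  refine weaklyDiscontinuous_iff.2 fun A hA => ?_
  obtain ⟨U, hU, hAU, hfU⟩ := weaklyDiscontinuous_iff.1 hf A hA
  obtain ⟨U', hU', ⟨_, ⟨x, hx, rfl⟩, hxU'⟩, hgU'⟩ :=
    weaklyDiscontinuous_iff.1 hg _ (hAU.image f)
  obtain ⟨O, hO, hOeq⟩ := continuousOn_iff'.1 hfU U' hU'
  have hsub : ∀ y ∈ A ∩ (U ∩ O), f y ∈ U' := fun y hy =>
    (hOeq.symm ▸ (⟨hy.2.2, hy.1, hy.2.1⟩ : y ∈ O ∩ (A ∩ U)) : y ∈ f ⁻¹' U' ∩ (A ∩ U)).1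
  have hxO : x ∈ O := (hOeq ▸ (⟨hxU', hx⟩ : x ∈ f ⁻¹' U' ∩ (A ∩ U)) : x ∈ O ∩ (A ∩ U)).1
  refine ⟨U ∩ O, hU.inter hO, ⟨x, hx.1, hx.2, hxO⟩, hgU'.comp (hfU.mono fun y hy =>
    ⟨hy.1, hy.2.1⟩) fun y hy => ⟨⟨y, ⟨hy.1, hy.2.1⟩, rfl⟩, hsub y hy⟩⟩

theorem ThetaWeaklyDiscontinuous.comp {g : Y → Z} {f : X → Y}
    (hg : ThetaWeaklyDiscontinuous g) (hf : ThetaWeaklyDiscontinuous f) :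
    ThetaWeaklyDiscontinuous (g ∘ f) := by
  intro A hA
  obtain ⟨V, hVne, hVc, hVθ⟩ := hf A hA
  obtain ⟨hVA, hVθ⟩ := isThetaOpenIn_iff.1 hVθ
  obtain ⟨V', hVne', hVc', hVθ'⟩ := hg _ (hVne.image f)
  obtain ⟨hVA', hVθ'⟩ := isThetaOpenIn_iff.1 hVθ'
  have hfV : ContinuousOn f V := fun x hx => (mem_contPts.1 (hVc hx)).2.mono hVA
  have hnhds : ∀ x ∈ V, V ∈ 𝓝[A] x := fun x hx => by
    obtain ⟨O, hO, hxO, hcl⟩ := hVθ x hx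
    exact mem_nhdsWithin.2 ⟨O, hO, hxO, fun y hy => hcl ⟨hy.2, subset_closure ⟨hy.2, hy.1⟩⟩⟩
  refine ⟨V ∩ f ⁻¹' V', ?_, ?_, isThetaOpenIn_iff.2 ⟨fun x hx => hVA hx.1, ?_⟩⟩
  · obtain ⟨y, hy⟩ := hVne'
    obtain ⟨x, hx, rfl⟩ := hVA' hy
    exact ⟨x, hx, hy⟩
  · rintro x ⟨hxV, hxV'⟩
    refine mem_contPts.2 ⟨hVA hxV, ContinuousWithinAt.mono_of_mem_nhdsWithin ?_ (hnhds x hxV)⟩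
    exact (mem_contPts.1 (hVc' hxV')).2.comp (hfV x hxV) (mapsTo_image f V)
  · rintro x ⟨hxV, hxV'⟩
    obtain ⟨O, hO, hxO, hcl⟩ := hVθ x hxV
    obtain ⟨O', hO', hxO', hcl'⟩ := hVθ' _ hxV'
    obtain ⟨P, hP, hPeq⟩ := continuousOn_iff'.1 hfV O' hO'
    have hxP : x ∈ P := (hPeq ▸ (⟨hxO', hxV⟩ : x ∈ f ⁻¹' O' ∩ V) : x ∈ P ∩ V).1
    refine ⟨O ∩ P, hO.inter hP, ⟨hxO, hxP⟩, fun y hy => ?_⟩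
    have hyV : y ∈ V :=
      hcl ⟨hy.1, closure_mono (inter_subset_inter_right A inter_subset_left) hy.2⟩
    refine ⟨hyV, hcl' ⟨mem_image_of_mem f hyV, ?_⟩⟩
    have hsub : A ∩ (O ∩ P) ⊆ V := fun z hz => hcl ⟨hz.1, subset_closure ⟨hz.1, hz.2.1⟩⟩
    refine ((hfV y hyV).mono hsub).mem_closure hy.2 fun z hz => ?_
    exact ⟨mem_image_of_mem f (hsub hz),
      (hPeq.symm ▸ (⟨hz.2.2, hsub hz⟩ : z ∈ P ∩ V) : z ∈ f ⁻¹' O' ∩ V).1⟩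

theorem WeaklyDiscontinuous.thetaWeaklyDiscontinuous [RegularSpace X] {f : X → Y}
    (hf : WeaklyDiscontinuous f) : ThetaWeaklyDiscontinuous f := by
  intro A hA
  obtain ⟨U, hU, hAU, hfU⟩ := weaklyDiscontinuous_iff.1 hf A hA
  refine ⟨A ∩ U, hAU, fun x hx => mem_contPts.2
    ⟨hx.1, (continuousWithinAt_inter (hU.mem_nhds hx.2)).1 (hfU x hx)⟩,
    isThetaOpenIn_iff.2 ⟨inter_subset_left, fun x hx => ?_⟩⟩
  obtain ⟨C, hC, hCc, hCU⟩ := exists_mem_nhds_isClosed_subset (hU.mem_nhds hx.2)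
  refine ⟨interior C, isOpen_interior, mem_interior_iff_mem_nhds.2 hC, fun y hy =>
    ⟨hy.1, hCU (closure_minimal (fun z hz => interior_subset hz.2) hCc hy.2)⟩⟩

theorem ScatteredlyContinuous.nonempty_interior_setOf_continuousAt [RegularSpace Y] [Nonempty X]
    {f : X → Y} (hf : ScatteredlyContinuous f) :
    (interior {x | ContinuousAt f x}).Nonempty := by
  by_contra hempty
  have hdense : Dense {x | ContinuousAt f x}ᶜ :=
    interior_eq_empty_iff_dense_compl.1 (not_nonempty_iff_eq_empty.1 hempty)
  obtain ⟨x, hxD, hx⟩ := hf.exists_continuousWithinAt hdense.nonempty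
  refine hxD ((closed_nhds_basis (f x)).tendsto_right_iff.2 fun C hC => ?_)
  obtain ⟨M, hM, hxM, hMC⟩ := mem_nhdsWithin.1 (hx hC.1)
  filter_upwards [hM.mem_nhds hxM] with z hzM
  by_contra hzC
  have hz : ContinuousAt f z := by
    by_contra hzD
    exact hzC (hMC ⟨hzM, hzD⟩)
  have hnhds : M ∩ f ⁻¹' Cᶜ ∈ 𝓝 z :=
    Filter.inter_mem (hM.mem_nhds hzM) (hz (hC.2.isOpen_compl.mem_nhds hzC))
  obtain ⟨y, hyD, hyM, hyC⟩ := hdense.inter_nhds_nonempty hnhds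
  exact hyC (hMC ⟨hyM, hyD⟩)

theorem ScatteredlyContinuous.weaklyDiscontinuous [RegularSpace Y] {f : X → Y}
    (hf : ScatteredlyContinuous f) : WeaklyDiscontinuous f := by
  intro A hA
  have := hA.to_subtype
  rw [preimage_val_contPts]
  exact (hf.comp_weaklyDiscontinuous
    continuous_subtype_val.weaklyDiscontinuous).nonempty_interior_setOf_continuousAt

/-- For a scatteredly continuous map there is a largest open set with nowhere dense preimage. -/
theorem ScatteredlyContinuous.isNowhereDense_preimage_sUnion {f : X → Y}
    (hf : ScatteredlyContinuous f) :
    IsNowhereDense (f ⁻¹' ⋃₀ {W | IsOpen W ∧ IsNowhereDense (f ⁻¹' W)}) := by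
  set W := ⋃₀ {W | IsOpen W ∧ IsNowhereDense (f ⁻¹' W)}
  by_contra hnd
  obtain ⟨p, hp⟩ := nonempty_iff_ne_empty.2 hnd
  have hne : (interior (closure (f ⁻¹' W)) ∩ f ⁻¹' W).Nonempty :=
    mem_closure_iff.1 (interior_subset hp) _ isOpen_interior hp
  obtain ⟨x, ⟨hxN, W', hW', hxW'⟩, hx⟩ := hf.exists_continuousWithinAt hne
  obtain ⟨M, hM, hxM, hMW⟩ := mem_nhdsWithin.1 (hx (hW'.1.mem_nhds hxW'))
  have hsub : M ∩ interior (closure (f ⁻¹' W)) ⊆ closure (f ⁻¹' W') := fun y hy =>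
    closure_mono (fun z hz => hMW ⟨hz.1.1, hz.1.2, hz.2⟩)
      ((hM.inter isOpen_interior).inter_closure ⟨hy, interior_subset hy.2⟩)
  have hmem := interior_maximal hsub (hM.inter isOpen_interior) ⟨hxM, hxN⟩
  rw [hW'.2] at hmem
  exact hmem

theorem ThetaWeaklyDiscontinuous.exists_continuousAt_comp [Nonempty X] {g : Y → Z} {f : X → Y}
    (hg : ThetaWeaklyDiscontinuous g) (hf : ScatteredlyContinuous f) :
    ∃ x, ContinuousAt (g ∘ f) x := by
  have hWnd := hf.isNowhereDense_preimage_sUnion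
  set W := ⋃₀ {W | IsOpen W ∧ IsNowhereDense (f ⁻¹' W)}
  have hWo : IsOpen W := isOpen_sUnion fun _ h => h.1
  have hWne : Wᶜ.Nonempty := by
    by_contra h
    rw [not_nonempty_iff_eq_empty, compl_empty_iff] at h
    simp [IsNowhereDense, h] at hWnd
  obtain ⟨V, ⟨v, hv⟩, hVc, hVθ⟩ := hg _ hWne
  obtain ⟨hVW, hVθ⟩ := isThetaOpenIn_iff.1 hVθ
  have hWVo : IsOpen (W ∪ V) := by
    refine isOpen_iff_mem_nhds.2 fun y hy => ?_
    rcases hy with hy | hy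
    · exact Filter.mem_of_superset (hWo.mem_nhds hy) subset_union_left
    · obtain ⟨O, hO, hyO, hcl⟩ := hVθ y hy
      filter_upwards [hO.mem_nhds hyO] with z hz
      by_cases hzW : z ∈ W
      · exact Or.inl hzW
      · exact Or.inr (hcl ⟨hzW, subset_closure ⟨hzW, hz⟩⟩)
  have hWVnd : ¬ IsNowhereDense (f ⁻¹' (W ∪ V)) := fun h =>
    hVW hv (mem_sUnion.2 ⟨W ∪ V, ⟨hWVo, h⟩, Or.inr hv⟩)
  obtain ⟨N, hNo, hNne, hNcl, hNW⟩ : ∃ N, IsOpen N ∧ N.Nonempty ∧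
      N ⊆ closure (f ⁻¹' (W ∪ V)) ∧ ∀ y ∈ N, f y ∈ Wᶜ := by
    refine ⟨interior (closure (f ⁻¹' (W ∪ V))) ∩ (closure (f ⁻¹' W))ᶜ,
      isOpen_interior.inter isClosed_closure.isOpen_compl, ?_,
      fun y hy => interior_subset hy.1, fun y hy hyW => hy.2 (subset_closure hyW)⟩
    by_contra hempty
    have hsub : interior (closure (f ⁻¹' (W ∪ V))) ⊆ closure (f ⁻¹' W) := fun y hy => by
      by_contra hyW
      exact hempty ⟨y, hy, hyW⟩
    exact hWVnd (subset_eq_empty (interior_maximal hsub isOpen_interior) hWnd)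
  have hmeet : ∀ P, IsOpen P → (P ∩ N).Nonempty → ∃ y ∈ P ∩ N, f y ∈ V := by
    rintro P hP ⟨p, hp⟩
    obtain ⟨y, hy, hyWV⟩ := mem_closure_iff.1 (hNcl hp.2) _ (hP.inter hNo) hp
    exact ⟨y, hy, hyWV.resolve_left (hNW y hy.2)⟩
  obtain ⟨b, hb, hbV⟩ := hmeet univ isOpen_univ (by simpa using hNne)
  obtain ⟨x, ⟨hxN, hxV⟩, hx⟩ :=
    hf.exists_continuousWithinAt (A := N ∩ f ⁻¹' V) ⟨b, hb.2, hbV⟩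
  obtain ⟨O, hO, hxO, hcl⟩ := hVθ _ hxV
  obtain ⟨M, hM, hxM, hMO⟩ := mem_nhdsWithin.1 (hx (hO.mem_nhds hxO))
  obtain ⟨z, hz, hzc⟩ := hf.exists_continuousWithinAt (A := M ∩ N) ⟨x, hxM, hxN⟩
  have hzc : ContinuousAt f z := hzc.continuousAt ((hM.inter hNo).mem_nhds hz)
  have hzV : f z ∈ V := by
    refine hcl ⟨hNW z hz.2, ?_⟩
    by_contra hzcl
    obtain ⟨P, hPsub, hP, hzP⟩ :=
      mem_nhds_iff.1 (hzc (isClosed_closure.isOpen_compl.mem_nhds hzcl))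
    obtain ⟨y, hy, hyV⟩ := hmeet (P ∩ M) (hP.inter hM) ⟨z, ⟨hzP, hz.1⟩, hz.2⟩
    exact hPsub hy.1.1 (subset_closure ⟨hNW y hy.2, hMO ⟨hy.1.2, hy.2, hyV⟩⟩)
  refine ⟨z, ContinuousWithinAt.continuousAt ?_ (hNo.mem_nhds hz.2)⟩
  exact (mem_contPts.1 (hVc hzV)).2.comp hzc.continuousWithinAt hNW

theorem ThetaWeaklyDiscontinuous.comp_scatteredlyContinuous {g : Y → Z} {f : X → Y}
    (hg : ThetaWeaklyDiscontinuous g) (hf : ScatteredlyContinuous f) :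
    ScatteredlyContinuous (g ∘ f) := by
  intro A hA
  have := hA.to_subtype
  obtain ⟨x, hx⟩ := hg.exists_continuousAt_comp
    (hf.comp_weaklyDiscontinuous (continuous_subtype_val (p := (· ∈ A))).weaklyDiscontinuous)
  exact ⟨x, x.2, hx⟩

end ThetaWeakRegularity

theorem swRegular_and_wThetaRegular_of_thetaWeaklyRegular {X : Type u} [TopologicalSpace X]
    (hX : ThetaWeaklyRegular.{v, u} X) : SwRegular.{w, u} X ∧ WThetaRegular.{w, u} X := by
  obtain ⟨Y, _, _, e, he, he'⟩ := hX
  constructor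
  · intro Z _ f hf
    have h := he'.weaklyDiscontinuous.comp (he.comp_scatteredlyContinuous hf).weaklyDiscontinuous
    rwa [← Function.comp_assoc, e.symm_comp_self, Function.id_comp] at h
  · intro T _ f hf
    have h := (hf.comp he'.weaklyDiscontinuous).thetaWeaklyDiscontinuous.comp he
    rwa [Function.comp_assoc, e.symm_comp_self, Function.comp_id] at h
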